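/- Fix s_j > 0, μ_j ∈ (0,1], ρ_j ≥ 1, ω > 0, n ∈ ℕ and j ∈ {1,2}. Let D_j := { v* + t_v e^{(−1)^{j+1} iπ/(2ρ_j)} : v* ∈ (0, s_j+1), |t_v| < 1 } ⊂ ℂ and define F_{n,ω}^{(j)}(v,w) := ((−1)^n/n!) (v−w)^n v^{μ_j−1} e^{(−1)^{j+1} iω v^{ρ_j}} for v ∈ ℂ∖(−∞,0] and w ∈ ℂ. Then for every w ∈ D_j: the integral H_{n,ω}^{(j)}(v,w) := −∫_{Λ^{(j)}(v)} F_{n,ω}^{(j)}(z,w) dz = ((−1)^{n+1}/n!) ∫_{Λ^{(j)}(v)} (z−w)^n z^{μ_j−1} e^{(−1)^{j+1} iω z^{ρ_j}} dz converges absolutely for every v ∈ D_j, the function v ↦ H_{n,ω}^{(j)}(v,w) is holomorphic on D_j, and its derivative satisfies ∂/∂v H_{n,ω}^{(j)}(v,w) = F_{n,ω}^{(j)}(v,w) for all v ∈ D_j; i.e. H_{n,ω}^{(j)}(·,w) is a primitive of F_{n,ω}^{(j)}(·,w) on D_j. -/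

import Mathlib

open MeasureTheory Set

/-- Direction of the ray `Λ^{(j)}(v)`: `e^{(−1)^{j+1} iπ/(2ρ)}`, encoded by the sign `σ`. -/
noncomputable def edir (σ ρ : ℝ) : ℂ := Complex.exp (Complex.I * ((σ * Real.pi / (2 * ρ) : ℝ) : ℂ))

/-- `F_{n,ω}^{(j)}(v,w) := ((−1)^n/n!) (v−w)^n v^{μ−1} e^{(−1)^{j+1} iω v^ρ}`,
complex powers being principal branches, `σ = (−1)^{j+1}`. -/
noncomputable def Ffun (σ ρ μ : ℝ) (n : ℕ) (ω : ℝ) (v w : ℂ) : ℂ :=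
  ((-1 : ℂ) ^ n / (Nat.factorial n : ℂ)) * (v - w) ^ n * (v ^ ((μ - 1 : ℝ) : ℂ)) *
    Complex.exp ((σ : ℂ) * Complex.I * (ω : ℂ) * (v ^ ((ρ : ℝ) : ℂ)))

/-- `H_{n,ω}^{(j)}(v,w) := −∫_{Λ^{(j)}(v)} F_{n,ω}^{(j)}(z,w) dz`, the ray
`Λ^{(j)}(v) = {v + t e^{(−1)^{j+1} iπ/(2ρ)} : t ≥ 0}` being parametrized by `t ≥ 0`. -/
noncomputable def Hfun (σ ρ μ : ℝ) (n : ℕ) (ω : ℝ) (v w : ℂ) : ℂ :=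
  -∫ t in Set.Ioi (0 : ℝ), Ffun σ ρ μ n ω (v + (t : ℂ) * edir σ ρ) w * edir σ ρ

/-- The open parallelogram `D_j = {v* + t_v e^{(−1)^{j+1} iπ/(2ρ)} : v* ∈ (0,s_j+1), |t_v| < 1}`. -/
def Dset (σ ρ sj : ℝ) : Set ℂ :=
  {z | ∃ v ∈ Set.Ioo (0 : ℝ) (sj + 1), ∃ tv ∈ Set.Ioo (-1 : ℝ) 1,
    z = (v : ℂ) + (tv : ℂ) * edir σ ρ}

/-- A nonnegative real factor may be pulled out of a complex power with real exponent. -/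
lemma ofReal_mul_cpow_ofReal {t : ℝ} (ht : 0 < t) (u : ℂ) (y : ℝ) :
    ((t : ℂ) * u) ^ (y : ℂ) = ((t ^ y : ℝ) : ℂ) * u ^ (y : ℂ) := by
  rw [Complex.cpow_ofReal, Complex.cpow_ofReal, Complex.arg_real_mul _ ht, norm_mul,
    Complex.norm_real, Real.norm_of_nonneg ht.le, Real.mul_rpow ht.le (norm_nonneg u)]
  push_cast
  ring

/-- Integrals along the rays `v + t e` of a holomorphic function decaying exponentially along
these rays, locally uniformly in `v`, converge absolutely and define a primitive. -/
lemma hasDerivAt_neg_integral_ray {f : ℂ → ℂ} {e : ℂ} {U : Set ℂ} {c : ℝ} (hc : 0 < c)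
    (hU : IsOpen U) (hUe : ∀ z ∈ U, ∀ t : ℝ, z + t * e ∈ U) (hf : DifferentiableOn ℂ f U)
    (hdecay : ∀ K ⊆ U, IsCompact K →
      ∃ C, ∀ z ∈ K, ∀ t : ℝ, 0 ≤ t → ‖f (z + t * e)‖ ≤ C * Real.exp (-c * t))
    {v : ℂ} (hv : v ∈ U) :
    IntegrableOn (fun t : ℝ => f (v + t * e) * e) (Ioi 0) ∧
      HasDerivAt (fun z : ℂ => -∫ t in Ioi (0 : ℝ), f (z + t * e) * e) (f v) v := by
  have hline : ∀ z : ℂ, Continuous fun t : ℝ => z + t * e := fun z => by fun_prop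
  have hcont : ∀ z ∈ U, ∀ g : ℂ → ℂ, ContinuousOn g U →
      Continuous fun t : ℝ => g (z + t * e) := fun z hz g hg =>
    hg.comp_continuous (hline z) (hUe z hz)
  have hdiff : ∀ z ∈ U, DifferentiableAt ℂ f z := fun z hz =>
    hf.differentiableAt (hU.mem_nhds hz)
  have hf'cont : ContinuousOn (deriv f) U := (hf.deriv hU).continuousOn
  have hexp : IntegrableOn (fun t : ℝ => Real.exp (-c * t)) (Ioi 0) :=
    exp_neg_integrableOn_Ioi 0 hc
  obtain ⟨R, hR, hball⟩ := Metric.isOpen_iff.1 hU v hv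
  set r := R / 3 with hr
  have hr0 : 0 < r := by positivity
  have hKU : Metric.closedBall v (2 * r) ⊆ U :=
    (Metric.closedBall_subset_ball (by linarith)).trans hball
  obtain ⟨C, hC⟩ := hdecay _ hKU (isCompact_closedBall v (2 * r))
  have hvK : v ∈ Metric.closedBall v (2 * r) := Metric.mem_closedBall_self (by positivity)
  have hint : IntegrableOn (fun t : ℝ => f (v + t * e) * e) (Ioi 0) := by
    refine Integrable.mono' ((hexp.const_mul C).mul_const ‖e‖)
      ((hcont v hv f hf.continuousOn).mul continuous_const).aestronglyMeasurable ?_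
    filter_upwards [ae_restrict_mem measurableSet_Ioi] with t ht
    rw [norm_mul]
    exact mul_le_mul_of_nonneg_right (hC v hvK t (le_of_lt ht)) (norm_nonneg e)
  refine ⟨hint, ?_⟩
  have hderiv_le : ∀ t ∈ Ioi (0 : ℝ), ∀ z ∈ Metric.ball v r,
      ‖deriv f (z + t * e)‖ ≤ C * Real.exp (-c * t) / r := by
    intro t ht z hz
    have hsub : ∀ y ∈ Metric.closedBall (z + t * e) r,
        y - t * e ∈ Metric.closedBall v (2 * r) := by
      intro y hy
      rw [Metric.mem_closedBall, dist_eq_norm] at hy ⊢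
      rw [Metric.mem_ball, dist_eq_norm] at hz
      calc ‖y - t * e - v‖ = ‖(y - (z + t * e)) + (z - v)‖ := by congr 1; ring
        _ ≤ ‖y - (z + t * e)‖ + ‖z - v‖ := norm_add_le _ _
        _ ≤ 2 * r := by linarith
    have hsubU : Metric.closedBall (z + t * e) r ⊆ U := fun y hy => by
      simpa using hUe _ (hKU (hsub y hy)) t
    refine Complex.norm_deriv_le_of_forall_mem_sphere_norm_le hr0 ?_ ?_
    · refine DifferentiableOn.diffContOnCl (hf.mono ?_)
      rwa [closure_ball _ hr0.ne']
    · intro y hy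
      simpa using hC _ (hsub y (Metric.sphere_subset_closedBall hy)) t (le_of_lt ht)
  have hballU : Metric.ball v r ⊆ U :=
    (Metric.ball_subset_ball (by linarith)).trans hball
  have key := hasDerivAt_integral_of_dominated_loc_of_deriv_le
    (μ := volume.restrict (Ioi (0 : ℝ))) (𝕜 := ℂ)
    (F := fun z t => f (z + (t : ℝ) * e) * e)
    (F' := fun z t => deriv f (z + (t : ℝ) * e) * e)
    (bound := fun t => C * Real.exp (-c * t) / r * ‖e‖)
    (Metric.ball_mem_nhds v hr0)
    (by
      filter_upwards [hU.mem_nhds hv] with z hz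
      exact ((hcont z hz f hf.continuousOn).mul continuous_const).aestronglyMeasurable)
    hint
    ((hcont v hv _ hf'cont).mul continuous_const).aestronglyMeasurable
    (by
      filter_upwards [ae_restrict_mem measurableSet_Ioi] with t ht z hz
      rw [norm_mul]
      exact mul_le_mul_of_nonneg_right (hderiv_le t ht z hz) (norm_nonneg e))
    (((hexp.const_mul C).div_const r).mul_const ‖e‖)
    (by
      refine Filter.Eventually.of_forall fun t z hz => ?_
      have h := (hdiff _ (hUe z (hballU hz) t)).hasDerivAt
      exact (h.comp_add_const z (t * e)).mul_const e)
  have htend : Filter.Tendsto (fun t : ℝ => f (v + t * e)) Filter.atTop (nhds 0) := by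
    have h0 : Filter.Tendsto (fun t : ℝ => C * Real.exp (-c * t)) Filter.atTop (nhds 0) := by
      have h1 : Filter.Tendsto (fun t : ℝ => -c * t) Filter.atTop Filter.atBot :=
        Filter.tendsto_id.const_mul_atTop_of_neg (by linarith)
      simpa using (Real.tendsto_exp_atBot.comp h1).const_mul C
    refine squeeze_zero_norm' ?_ h0
    filter_upwards [Filter.eventually_ge_atTop 0] with t ht using hC v hvK t ht
  have hFTC := integral_Ioi_of_hasDerivAt_of_tendsto (a := 0)
    (f := fun t : ℝ => f (v + t * e)) (f' := fun t : ℝ => deriv f (v + t * e) * e)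
    (hcont v hv f hf.continuousOn).continuousWithinAt
    (fun t _ => by
      have h := (hdiff _ (hUe v hv t)).hasDerivAt
      have hl : HasDerivAt (fun s : ℝ => v + s * e) e t := by
        simpa using ((Complex.ofRealCLM.hasDerivAt (x := t)).mul_const e).const_add v
      exact h.comp t hl)
    key.1 htend
  have h := key.2.fun_neg
  rwa [hFTC, Complex.ofReal_zero, zero_mul, add_zero, zero_sub, neg_neg] at h

section

variable {σ ρ μ ω : ℝ}

lemma norm_edir (σ ρ : ℝ) : ‖edir σ ρ‖ = 1 := by
  rw [edir, mul_comm, Complex.norm_exp_ofReal_mul_I]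

lemma edir_eq_exp_arg_mul_I (σ ρ : ℝ) :
    edir σ ρ = Complex.exp (((σ * Real.pi / (2 * ρ) : ℝ) : ℂ) * Complex.I) := by
  rw [edir, mul_comm]

lemma sin_angle_pos (hρ : 1 ≤ ρ) : 0 < Real.sin (Real.pi / (2 * ρ)) := by
  have hpi := Real.pi_pos
  refine Real.sin_pos_of_pos_of_lt_pi (by positivity) ?_
  rw [div_lt_iff₀ (by positivity)]
  nlinarith

lemma sign_mul_edir_im_pos (hσ : σ = 1 ∨ σ = -1) (hρ : 1 ≤ ρ) : 0 < σ * (edir σ ρ).im := by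
  have h := sin_angle_pos hρ
  rw [edir_eq_exp_arg_mul_I, Complex.exp_ofReal_mul_I_im]
  rcases hσ with rfl | rfl
  · simpa using h
  · simpa [neg_div, Real.sin_neg] using h

lemma edir_mem_slitPlane (hσ : σ = 1 ∨ σ = -1) (hρ : 1 ≤ ρ) :
    edir σ ρ ∈ Complex.slitPlane := by
  refine Complex.mem_slitPlane_iff.2 (Or.inr fun h => ?_)
  have := sign_mul_edir_im_pos hσ hρ
  simp [h] at this

lemma edir_cpow (hσ : σ = 1 ∨ σ = -1) (hρ : 1 ≤ ρ) :
    edir σ ρ ^ ((ρ : ℝ) : ℂ) = σ * Complex.I := by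
  have hpi := Real.pi_pos
  have hle : Real.pi / (2 * ρ) ≤ Real.pi / 2 :=
    div_le_div_of_nonneg_left hpi.le two_pos (by linarith)
  have hpos : 0 < Real.pi / (2 * ρ) := by positivity
  have harg : (edir σ ρ).arg = σ * Real.pi / (2 * ρ) := by
    rw [edir_eq_exp_arg_mul_I, Complex.arg_exp_mul_I, toIocMod_eq_self]
    rcases hσ with rfl | rfl
    · rw [one_mul]; constructor <;> linarith
    · rw [neg_one_mul, neg_div]; constructor <;> linarith
  have hang : σ * Real.pi / (2 * ρ) * ρ = σ * (Real.pi / 2) := by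
    field_simp
  rw [Complex.cpow_ofReal, harg, norm_edir, hang]
  rcases hσ with rfl | rfl <;> simp [Real.sin_neg]

/-- The open half-plane swept out by the full lines of direction `edir σ ρ` through the
positive real axis. -/
def rayHalfPlane (σ ρ : ℝ) : Set ℂ :=
  {z | 0 < σ * (z.re * (edir σ ρ).im - z.im * (edir σ ρ).re)}

lemma isOpen_rayHalfPlane (σ ρ : ℝ) : IsOpen (rayHalfPlane σ ρ) :=
  isOpen_lt continuous_const (by fun_prop)

lemma add_mul_edir_mem_rayHalfPlane {z : ℂ} (hz : z ∈ rayHalfPlane σ ρ) (t : ℝ) :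
    z + t * edir σ ρ ∈ rayHalfPlane σ ρ := by
  simp only [rayHalfPlane, mem_ofPred_eq, Complex.add_re, Complex.add_im, Complex.re_ofReal_mul,
    Complex.im_ofReal_mul] at hz ⊢
  convert hz using 1
  ring

lemma rayHalfPlane_subset_slitPlane (hσ : σ = 1 ∨ σ = -1) (hρ : 1 ≤ ρ) :
    rayHalfPlane σ ρ ⊆ Complex.slitPlane := by
  intro z hz
  rw [Complex.mem_slitPlane_iff]
  by_cases him : z.im = 0
  · left
    have h := sign_mul_edir_im_pos hσ hρ
    simp only [rayHalfPlane, mem_ofPred_eq, him, zero_mul, sub_zero] at hz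
    rw [mul_left_comm] at hz
    exact pos_of_mul_pos_left hz h.le
  · exact Or.inr him

lemma Dset_subset_rayHalfPlane (hσ : σ = 1 ∨ σ = -1) (hρ : 1 ≤ ρ) (sj : ℝ) :
    Dset σ ρ sj ⊆ rayHalfPlane σ ρ := by
  rintro _ ⟨v, hv, t, -, rfl⟩
  refine add_mul_edir_mem_rayHalfPlane ?_ t
  have h := mul_pos hv.1 (sign_mul_edir_im_pos hσ hρ)
  simp only [rayHalfPlane, mem_ofPred_eq, Complex.ofReal_re, Complex.ofReal_im, zero_mul, sub_zero]
  rwa [mul_left_comm]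

lemma differentiableOn_Ffun (σ ρ μ : ℝ) (n : ℕ) (ω : ℝ) (w : ℂ) :
    DifferentiableOn ℂ (fun z => Ffun σ ρ μ n ω z w) Complex.slitPlane := by
  intro z hz
  have h : ∀ c : ℂ, DifferentiableAt ℂ (fun z : ℂ => z ^ c) z := fun c =>
    differentiableAt_id.cpow_const hz
  have h1 := h ((μ - 1 : ℝ) : ℂ)
  have h2 := h ((ρ : ℝ) : ℂ)
  unfold Ffun
  exact DifferentiableAt.differentiableWithinAt (by fun_prop)

/-- Exponential decay of the integrand in a sector around the direction `edir σ ρ`. -/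
lemma exists_norm_Ffun_mul_le (hσ : σ = 1 ∨ σ = -1) (hρ : 1 ≤ ρ) (hμ : μ ≤ 1) (hω : 0 < ω)
    (n : ℕ) (w : ℂ) :
    ∃ δ > 0, ∃ M : ℝ, ∀ u : ℂ, ‖u - edir σ ρ‖ < δ → ∀ t : ℝ, 1 ≤ t →
      ‖Ffun σ ρ μ n ω (t * u) w‖ ≤ M * Real.exp (-(ω / 4) * t) := by
  have he := edir_mem_slitPlane hσ hρ
  have hpow : ContinuousAt (fun u : ℂ => ‖u ^ ((μ - 1 : ℝ) : ℂ)‖) (edir σ ρ) :=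
    (continuousAt_cpow_const he).norm
  have hexp : ContinuousAt (fun u : ℂ => ((σ : ℂ) * Complex.I * (ω : ℂ) * u ^ ((ρ : ℝ) : ℂ)).re)
      (edir σ ρ) :=
    Complex.continuous_re.continuousAt.comp
      (continuousAt_const.mul (continuousAt_cpow_const he))
  have hval : ((σ : ℂ) * Complex.I * (ω : ℂ) * edir σ ρ ^ ((ρ : ℝ) : ℂ)).re = -ω := by
    rw [edir_cpow hσ hρ]
    rcases hσ with rfl | rfl <;> simp
  set A := ‖edir σ ρ ^ ((μ - 1 : ℝ) : ℂ)‖ + 1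
  have hev1 : ∀ᶠ u in nhds (edir σ ρ), ‖u ^ ((μ - 1 : ℝ) : ℂ)‖ < A :=
    hpow.eventually_lt_const (lt_add_one _)
  have hev2 : ∀ᶠ u in nhds (edir σ ρ),
      ((σ : ℂ) * Complex.I * (ω : ℂ) * u ^ ((ρ : ℝ) : ℂ)).re < -(ω / 2) :=
    hexp.eventually_lt_const (hval.trans_lt (by linarith))
  obtain ⟨δ, hδ, hball⟩ := Metric.eventually_nhds_iff.1
    ((hev1.and hev2).and (Metric.ball_mem_nhds _ one_pos))
  refine ⟨δ, hδ, (1 / n.factorial) * (2 + ‖w‖) ^ n * A * (n.factorial * (4 / ω) ^ n), ?_⟩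
  intro u hu t ht
  obtain ⟨⟨hu1, hu2⟩, hu3⟩ := hball (by rwa [dist_eq_norm])
  have ht0 : 0 < t := by linarith
  have hunorm : ‖u‖ ≤ 2 := by
    have h1 : ‖u - edir σ ρ‖ < 1 := by simpa [dist_eq_norm] using hu3
    have h2 := norm_le_norm_add_norm_sub' u (edir σ ρ)
    rw [norm_edir] at h2
    linarith
  have hB1 : ‖((-1 : ℂ) ^ n / (Nat.factorial n : ℂ))‖ = 1 / n.factorial := by simp
  have hB2 : ‖((t : ℂ) * u - w) ^ n‖ ≤ t ^ n * (2 + ‖w‖) ^ n := by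
    rw [norm_pow, ← mul_pow]
    refine pow_le_pow_left₀ (norm_nonneg _) ?_ n
    calc ‖(t : ℂ) * u - w‖ ≤ ‖(t : ℂ) * u‖ + ‖w‖ := norm_sub_le _ _
      _ = t * ‖u‖ + ‖w‖ := by rw [norm_mul, Complex.norm_real, Real.norm_of_nonneg ht0.le]
      _ ≤ t * (2 + ‖w‖) := by nlinarith [norm_nonneg w]
  have hB3 : ‖((t : ℂ) * u) ^ ((μ - 1 : ℝ) : ℂ)‖ ≤ A := by
    rw [ofReal_mul_cpow_ofReal ht0, norm_mul, Complex.norm_real,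
      Real.norm_of_nonneg (Real.rpow_nonneg ht0.le _)]
    have h1 : t ^ (μ - 1) ≤ 1 := Real.rpow_le_one_of_one_le_of_nonpos ht (by linarith)
    calc t ^ (μ - 1) * ‖u ^ ((μ - 1 : ℝ) : ℂ)‖ ≤ 1 * ‖u ^ ((μ - 1 : ℝ) : ℂ)‖ :=
          mul_le_mul_of_nonneg_right h1 (norm_nonneg _)
      _ ≤ A := by rw [one_mul]; exact hu1.le
  have hB4 : ‖Complex.exp ((σ : ℂ) * Complex.I * (ω : ℂ) * ((t : ℂ) * u) ^ ((ρ : ℝ) : ℂ))‖ ≤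
      Real.exp (-(ω / 4) * t) * Real.exp (-(ω / 4 * t)) := by
    rw [Complex.norm_exp, ofReal_mul_cpow_ofReal ht0, mul_left_comm, Complex.re_ofReal_mul,
      ← Real.exp_add]
    refine Real.exp_le_exp.2 ?_
    have h1 : t ≤ t ^ ρ := Real.self_le_rpow_of_one_le ht hρ
    nlinarith
  have hB5 : t ^ n * Real.exp (-(ω / 4 * t)) ≤ n.factorial * (4 / ω) ^ n := by
    have h := Real.pow_div_factorial_le_exp (ω / 4 * t) (by positivity) n
    rw [div_le_iff₀ (by positivity)] at h
    rw [Real.exp_neg, ← div_eq_mul_inv, div_le_iff₀ (Real.exp_pos _)]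
    calc t ^ n = (4 / ω) ^ n * (ω / 4 * t) ^ n := by
          rw [← mul_pow]; congr 1; field_simp
      _ ≤ (4 / ω) ^ n * (Real.exp (ω / 4 * t) * n.factorial) :=
          mul_le_mul_of_nonneg_left h (by positivity)
      _ = _ := by ring
  have hA0 : 0 ≤ A := by positivity
  rw [Ffun, norm_mul, norm_mul, norm_mul, hB1]
  calc _ ≤ 1 / n.factorial * (t ^ n * (2 + ‖w‖) ^ n) * A *
        (Real.exp (-(ω / 4) * t) * Real.exp (-(ω / 4 * t))) := by gcongr
    _ = 1 / n.factorial * (2 + ‖w‖) ^ n * A * (t ^ n * Real.exp (-(ω / 4 * t))) *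
        Real.exp (-(ω / 4) * t) := by ring
    _ ≤ _ := by gcongr

/-- Exponential decay of the integrand along rays, uniformly on compact sets of base points. -/
lemma exists_norm_Ffun_ray_le (hσ : σ = 1 ∨ σ = -1) (hρ : 1 ≤ ρ) (hμ : μ ≤ 1) (hω : 0 < ω)
    (n : ℕ) (w : ℂ) {K : Set ℂ} (hKU : K ⊆ rayHalfPlane σ ρ) (hK : IsCompact K) :
    ∃ C, ∀ z ∈ K, ∀ t : ℝ, 0 ≤ t →
      ‖Ffun σ ρ μ n ω (z + t * edir σ ρ) w‖ ≤ C * Real.exp (-(ω / 4) * t) := by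
  obtain ⟨δ, hδ, M, hM⟩ := exists_norm_Ffun_mul_le hσ hρ hμ hω n w
  obtain ⟨R, hR0, hR⟩ := hK.isBounded.exists_pos_norm_le
  set T := max 1 ((R + 1) / δ)
  have hcont : ContinuousOn (fun p : ℂ × ℝ => Ffun σ ρ μ n ω (p.1 + p.2 * edir σ ρ) w)
      (K ×ˢ Icc 0 T) := by
    refine (differentiableOn_Ffun σ ρ μ n ω w).continuousOn.comp
      (f := fun p : ℂ × ℝ => p.1 + p.2 * edir σ ρ) (by fun_prop) ?_
    rintro ⟨z, t⟩ ⟨hz, -⟩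
    exact rayHalfPlane_subset_slitPlane hσ hρ (add_mul_edir_mem_rayHalfPlane (hKU hz) t)
  obtain ⟨B, hB⟩ := (hK.prod isCompact_Icc).exists_bound_of_continuousOn hcont
  refine ⟨max M (B * Real.exp (ω / 4 * T)), fun z hz t ht => ?_⟩
  rcases le_total t T with htT | hTt
  · have h := hB (z, t) ⟨hz, ht, htT⟩
    have hB0 : 0 ≤ B := (norm_nonneg _).trans h
    calc _ ≤ B := h
      _ ≤ B * (Real.exp (ω / 4 * T) * Real.exp (-(ω / 4) * t)) := by
        refine le_mul_of_one_le_right hB0 ?_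
        rw [← Real.exp_add]
        exact Real.one_le_exp (by nlinarith)
      _ = B * Real.exp (ω / 4 * T) * Real.exp (-(ω / 4) * t) := by ring
      _ ≤ _ := mul_le_mul_of_nonneg_right (le_max_right _ _) (Real.exp_pos _).le
  · have ht1 : 1 ≤ t := (le_max_left _ _).trans hTt
    have ht0 : 0 < t := by linarith
    have htC : (t : ℂ) ≠ 0 := by exact_mod_cast ht0.ne'
    have hlt : ‖(edir σ ρ + z / t) - edir σ ρ‖ < δ := by
      rw [add_sub_cancel_left, norm_div, Complex.norm_real, Real.norm_of_nonneg ht0.le,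
        div_lt_iff₀ ht0]
      have h1 : (R + 1) / δ ≤ t := (le_max_right _ _).trans hTt
      rw [div_le_iff₀ hδ] at h1
      linarith [hR z hz]
    have h := hM _ hlt t ht1
    have heq : (t : ℂ) * (edir σ ρ + z / t) = z + t * edir σ ρ := by
      field_simp
      ring
    rw [heq] at h
    exact h.trans (mul_le_mul_of_nonneg_right (le_max_left _ _) (Real.exp_pos _).le)

end

/-- Theorem 5.4: for every `w ∈ D_j`, the integral defining `H_{n,ω}^{(j)}(·,w)` converges
absolutely at every `v ∈ D_j`, and `H_{n,ω}^{(j)}(·,w)` is a holomorphic primitive of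
`F_{n,ω}^{(j)}(·,w)` on `D_j`. -/
theorem stmt19 (σ ρ μ sj ω : ℝ) (n : ℕ)
    (hσ : σ = 1 ∨ σ = -1) (hρ : 1 ≤ ρ) (hμ : 0 < μ ∧ μ ≤ 1) (hsj : 0 < sj) (hω : 0 < ω) :
    ∀ w ∈ Dset σ ρ sj,
      (∀ v ∈ Dset σ ρ sj,
        MeasureTheory.IntegrableOn
          (fun t : ℝ => Ffun σ ρ μ n ω (v + (t : ℂ) * edir σ ρ) w * edir σ ρ)
          (Set.Ioi 0)) ∧
      (∀ v ∈ Dset σ ρ sj,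
        HasDerivAt (fun z : ℂ => Hfun σ ρ μ n ω z w) (Ffun σ ρ μ n ω v w) v) := by
  intro w _
  have hmain := fun v (hv : v ∈ Dset σ ρ sj) =>
    hasDerivAt_neg_integral_ray (f := fun z => Ffun σ ρ μ n ω z w) (e := edir σ ρ)
      (c := ω / 4) (by positivity) (isOpen_rayHalfPlane σ ρ)
      (fun _ => add_mul_edir_mem_rayHalfPlane)
      ((differentiableOn_Ffun σ ρ μ n ω w).mono (rayHalfPlane_subset_slitPlane hσ hρ))
      (fun _ hKU hK => exists_norm_Ffun_ray_le hσ hρ hμ.2 hω n w hKU hK)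
      (Dset_subset_rayHalfPlane hσ hρ sj hv)
  exact ⟨fun v hv => (hmain v hv).1, fun v hv => (hmain v hv).2⟩
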